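/- Let d ≥ 1 be an integer, let 0 < α < d/2 and let a ∈ ℝ satisfy |a| < 𝓗_{d,2α}^{1/2}. For every Schwartz function f : ℝ^d → ℂ, let |p|^α f denote the inverse Fourier transform of the function ξ ↦ (2π|ξ|)^α 𝓕f(ξ). Then ‖ |p|^α f + a |x|^{-α} f ‖_{L²(ℝ^d)} ≥ (1 − |a| · 𝓗_{d,2α}^{-1/2}) · ‖ |p|^α f ‖_{L²(ℝ^d)}. -/

import Mathlib

open MeasureTheory Real FourierTransform
open scoped ENNReal SchwartzMap

variable {V : Type*} [NormedAddCommGroup V] [InnerProductSpace ℝ V]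

section Plancherel

variable [FiniteDimensional ℝ V] [MeasurableSpace V] [BorelSpace V]

/-- The Fourier transform is self-adjoint for the bilinear pairing of integrable functions. -/
theorem integral_fourier_mul_eq_of_integrable {u v : V → ℂ} (hu : Integrable u)
    (hv : Integrable v) : ∫ ξ, 𝓕 u ξ * v ξ = ∫ x, u x * 𝓕 v x := by
  have h := VectorFourier.integral_fourierIntegral_smul_eq_flip (L := innerₗ V)
    Real.continuous_fourierChar continuous_inner hu hv
  simpa using! h

/-- On `L¹ ∩ L²`, the integral Fourier transform agrees with the one on `L²`. -/
theorem fourier_toLp_ae_eq {g : V → ℂ} (hg : Integrable g) (hg2 : MemLp g 2) :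
    (𝓕 (hg2.toLp g) : Lp ℂ 2 (volume : Measure V)) =ᵐ[volume] 𝓕 g := by
  have hc : Continuous (𝓕 g) := VectorFourier.fourierIntegral_continuous
    Real.continuous_fourierChar continuous_inner hg
  refine ae_eq_of_integral_contDiff_smul_eq
    ((Lp.memLp _).locallyIntegrable (by norm_num)) hc.locallyIntegrable fun φ hφ hφc ↦ ?_
  have hs : HasCompactSupport (fun x ↦ (φ x : ℂ)) := hφc.comp_left (g := Complex.ofReal) rfl
  let ψ : 𝓢(V, ℂ) := hs.toSchwartzMap (Complex.ofRealCLM.contDiff.comp hφ)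
  have h1 := Lp.toTemperedDistribution_apply (𝓕 (hg2.toLp g) : Lp ℂ 2 (volume : Measure V)) ψ
  rw [← Lp.fourier_toTemperedDistribution_eq, TemperedDistribution.fourier_apply,
    Lp.toTemperedDistribution_apply] at h1
  have h2 : ∫ x, (𝓕 ψ) x • (hg2.toLp g) x = ∫ x, (𝓕 ψ) x * g x :=
    integral_congr_ae (by filter_upwards [hg2.coeFn_toLp] with x hx; rw [hx, smul_eq_mul])
  have h3 := integral_fourier_mul_eq_of_integrable ψ.integrable hg
  rw [h2, SchwartzMap.fourier_coe, h3] at h1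
  have hψ : ∀ x, ψ x = φ x := fun _ ↦ rfl
  simpa [hψ] using h1.symm

/-- Plancherel's theorem for functions in `L¹ ∩ L²`. -/
theorem eLpNorm_fourier_eq {g : V → ℂ} (hg : Integrable g) (hg2 : MemLp g 2) :
    eLpNorm (𝓕 g) 2 volume = eLpNorm g 2 volume := by
  rw [← eLpNorm_congr_ae (fourier_toLp_ae_eq hg hg2), ← eLpNorm_congr_ae hg2.coeFn_toLp,
    ← Lp.enorm_def, ← Lp.enorm_def, ← ofReal_norm, ← ofReal_norm, Lp.norm_fourier_eq]

theorem eLpNorm_fourierInv_eq {g : V → ℂ} (hg : Integrable g) (hg2 : MemLp g 2) :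
    eLpNorm (𝓕⁻ g) 2 volume = eLpNorm g 2 volume := by
  rw [← eLpNorm_fourier_eq hg hg2]
  have : (𝓕⁻ g) = 𝓕 g ∘ Neg.neg := by
    ext x; exact fourierInv_eq_fourier_neg g x
  rw [this]
  exact eLpNorm_comp_measurePreserving (VectorFourier.fourierIntegral_continuous
    Real.continuous_fourierChar continuous_inner hg).aestronglyMeasurable
    (Measure.measurePreserving_neg volume)

end Plancherel

/-- A Schwartz function multiplied by a homogeneous weight is dominated by a Schwartz function. -/
theorem exists_schwartz_norm_rpow_mul_le {α : ℝ} (hα : 0 ≤ α) {c : ℝ} (hc : 0 ≤ c)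
    (f : 𝓢(V, ℂ)) :
    ∃ g : 𝓢(V, ℂ), ∀ x, ‖(((c * ‖x‖) ^ α : ℝ) : ℂ) * f x‖ ≤ ‖g x‖ := by
  have hT := Function.hasTemperateGrowth_one_add_norm_sq_rpow (H := V) α
  refine ⟨SchwartzMap.smulLeftCLM ℂ (fun x : V ↦ (1 + ‖x‖ ^ 2) ^ α)
    (((c ^ α : ℝ) : ℂ) • f), fun x ↦ ?_⟩
  rw [SchwartzMap.smulLeftCLM_apply_apply hT]
  have : ‖x‖ ^ α ≤ (1 + ‖x‖ ^ 2) ^ α :=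
    rpow_le_rpow (norm_nonneg _) (by nlinarith [sq_nonneg (‖x‖ - 1)]) hα
  rw [norm_mul, norm_smul, smul_apply, norm_smul, Complex.norm_real, Complex.norm_real,
    mul_rpow hc (norm_nonneg _), Real.norm_of_nonneg (by positivity),
    Real.norm_of_nonneg (by positivity), Real.norm_of_nonneg (by positivity)]
  calc c ^ α * ‖x‖ ^ α * ‖f x‖ = ‖x‖ ^ α * (c ^ α * ‖f x‖) := by ring
    _ ≤ _ := by gcongr

theorem lintegral_rpow_mul_exp_neg_mul_Ioi {c r : ℝ} (hc : 0 < c) (hr : 0 < r) :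
    ∫⁻ t in Set.Ioi (0 : ℝ), ENNReal.ofReal (t ^ (c - 1) * exp (-(r * t))) =
      ENNReal.ofReal (Gamma c * r ^ (-c)) := by
  have h := Real.integral_rpow_mul_exp_neg_mul_Ioi hc hr
  rw [one_div, inv_rpow hr.le, ← rpow_neg hr.le, mul_comm] at h
  rw [← h, ofReal_integral_eq_lintegral_ofReal]
  · refine Integrable.of_integral_ne_zero ?_
    rw [h]; exact (mul_pos (Gamma_pos_of_pos hc) (rpow_pos_of_pos hr _)).ne'
  · filter_upwards [ae_restrict_mem measurableSet_Ioi] with t ht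
    have : (0 : ℝ) < t := ht
    positivity

theorem lintegral_rpow_mul_exp_neg_div_Ioi {c r : ℝ} (hc : 0 < c) (hr : 0 < r) :
    ∫⁻ t in Set.Ioi (0 : ℝ), ENNReal.ofReal (t ^ (-c - 1) * exp (-(r / t))) =
      ENNReal.ofReal (Gamma c * r ^ (-c)) := by
  have h := Real.integral_rpow_mul_exp_neg_mul_Ioi hc hr
  rw [one_div, inv_rpow hr.le, ← rpow_neg hr.le, mul_comm,
    ← integral_comp_rpow_Ioi _ (p := -1) (by norm_num)] at h
  have hcongr : ∫ t in Set.Ioi (0 : ℝ), t ^ (-c - 1) * exp (-(r / t)) = Gamma c * r ^ (-c) := by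
    rw [← h]
    refine setIntegral_congr_fun measurableSet_Ioi fun t ht ↦ ?_
    have ht : (0 : ℝ) < t := ht
    simp only [abs_neg, abs_one, one_mul, smul_eq_mul]
    rw [← rpow_mul ht.le, ← mul_assoc, ← rpow_add ht, rpow_neg_one, div_eq_mul_inv]
    congr 2; ring
  rw [← hcongr, ofReal_integral_eq_lintegral_ofReal]
  · refine Integrable.of_integral_ne_zero ?_
    rw [hcongr]; exact (mul_pos (Gamma_pos_of_pos hc) (rpow_pos_of_pos hr _)).ne'
  · filter_upwards [ae_restrict_mem measurableSet_Ioi] with t ht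
    have : (0 : ℝ) < t := ht
    positivity

theorem lintegral_comp_mul_left_of_pos {r : ℝ} (hr : 0 < r) (g : ℝ → ℝ≥0∞) :
    ∫⁻ x, g x = ENNReal.ofReal r * ∫⁻ x, g (r * x) := by
  conv_lhs => rw [← Real.smul_map_volume_mul_left hr.ne']
  rw [lintegral_smul_measure, abs_of_pos hr]
  congr 1
  exact (Homeomorph.mulLeft₀ r hr.ne').measurableEmbedding.lintegral_map g

theorem lintegral_Ioo_rpow_mul_sub_rpow {a b r : ℝ} (ha : 0 < a) (hb : 0 < b) (hr : 0 < r) :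
    ∫⁻ t in Set.Ioo 0 r, ENNReal.ofReal (t ^ (a - 1) * (r - t) ^ (b - 1)) =
      ENNReal.ofReal (ProbabilityTheory.beta a b * r ^ (a + b - 1)) := by
  have hB := ProbabilityTheory.beta_pos ha hb
  have h := ProbabilityTheory.lintegral_betaPDF_eq_one ha hb
  rw [ProbabilityTheory.lintegral_betaPDF] at h
  rw [← lintegral_indicator measurableSet_Ioo, lintegral_comp_mul_left_of_pos hr]
  calc _ = ENNReal.ofReal r * ∫⁻ s, ENNReal.ofReal (ProbabilityTheory.beta a b * r ^ (a + b - 2)) *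
        (Set.Ioo 0 1).indicator (fun x ↦ ENNReal.ofReal (1 / ProbabilityTheory.beta a b *
          x ^ (a - 1) * (1 - x) ^ (b - 1))) s := by
        congr 1
        refine lintegral_congr fun s ↦ ?_
        by_cases hs : s ∈ Set.Ioo (0 : ℝ) 1
        · have hs' : r * s ∈ Set.Ioo 0 r := ⟨by nlinarith [hs.1], by nlinarith [hs.2]⟩
          rw [Set.indicator_of_mem hs, Set.indicator_of_mem hs',
            ← ENNReal.ofReal_mul (by positivity)]
          congr 1
          rw [show r - r * s = r * (1 - s) by ring, mul_rpow hr.le hs.1.le,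
            mul_rpow hr.le (by linarith [hs.2]), show a + b - 2 = (a - 1) + (b - 1) by ring,
            rpow_add hr]
          field_simp
        · have hs' : r * s ∉ Set.Ioo 0 r := by
            rintro ⟨h1, h2⟩
            exact hs ⟨pos_of_mul_pos_right h1 hr.le, by nlinarith⟩
          rw [Set.indicator_of_notMem hs, Set.indicator_of_notMem hs', mul_zero]
    _ = _ := by
        rw [lintegral_const_mul' _ _ ENNReal.ofReal_ne_top, lintegral_indicator measurableSet_Ioo, h,
          mul_one, ← ENNReal.ofReal_mul hr.le]
        congr 1
        rw [show a + b - 1 = (a + b - 2) + 1 by ring, rpow_add_one hr.ne']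
        ring

/-- Beta integral in superposition form. -/
theorem lintegral_lintegral_rpow_mul_rpow_comp_add {a b : ℝ} (ha : 0 < a) (hb : 0 < b)
    {F : ℝ → ℝ≥0∞} (hF : Measurable F) :
    ∫⁻ t in Set.Ioi (0 : ℝ), ENNReal.ofReal (t ^ (a - 1)) *
        ∫⁻ s in Set.Ioi (0 : ℝ), ENNReal.ofReal (s ^ (b - 1)) * F (t + s) =
      ENNReal.ofReal (ProbabilityTheory.beta a b) *
        ∫⁻ r in Set.Ioi (0 : ℝ), ENNReal.ofReal (r ^ (a + b - 1)) * F r := by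
  set A : ℝ → ℝ≥0∞ := (Set.Ioi 0).indicator fun t ↦ ENNReal.ofReal (t ^ (a - 1)) with hA
  set B : ℝ → ℝ≥0∞ := (Set.Ioi 0).indicator fun t ↦ ENNReal.ofReal (t ^ (b - 1)) with hB
  have hAm : Measurable A := Measurable.indicator (by fun_prop) measurableSet_Ioi
  have hBm : Measurable B := Measurable.indicator (by fun_prop) measurableSet_Ioi
  have hinner (t : ℝ) : ∫⁻ s in Set.Ioi (0 : ℝ), ENNReal.ofReal (s ^ (b - 1)) * F (t + s) =
      ∫⁻ r, B (r - t) * F r := by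
    rw [← lintegral_indicator measurableSet_Ioi,
      ← lintegral_sub_right_eq_self (fun s ↦ (Set.Ioi 0).indicator _ s) t]
    refine lintegral_congr fun r ↦ ?_
    rw [Set.indicator_mul_left]
    simp [hB]
  have hconv (r : ℝ) : ∫⁻ t, A t * B (r - t) = (Set.Ioi 0).indicator (fun r ↦
      ENNReal.ofReal (ProbabilityTheory.beta a b * r ^ (a + b - 1))) r := by
    have hAB (t : ℝ) : A t * B (r - t) = (Set.Ioo 0 r).indicator
        (fun t ↦ ENNReal.ofReal (t ^ (a - 1) * (r - t) ^ (b - 1))) t := by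
      by_cases h1 : 0 < t <;> by_cases h2 : t < r <;> simp [hA, hB, Set.indicator, h1, h2]
      rw [ENNReal.ofReal_mul (by positivity)]
    simp_rw [hAB]
    rw [lintegral_indicator measurableSet_Ioo]
    by_cases hr : 0 < r
    · rw [lintegral_Ioo_rpow_mul_sub_rpow ha hb hr, Set.indicator_of_mem (by simpa using hr)]
    · rw [Set.Ioo_eq_empty hr, Set.indicator_of_notMem (by simpa using hr)]
      simp
  simp_rw [hinner]
  calc _ = ∫⁻ t, ∫⁻ r, A t * (B (r - t) * F r) := by
        rw [← lintegral_indicator measurableSet_Ioi]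
        refine lintegral_congr fun t ↦ ?_
        rw [lintegral_const_mul _ (by fun_prop), hA, Set.indicator_mul_left]
    _ = ∫⁻ r, ∫⁻ t, A t * (B (r - t) * F r) := lintegral_lintegral_swap (by fun_prop)
    _ = ∫⁻ r, (∫⁻ t, A t * B (r - t)) * F r := by
        refine lintegral_congr fun r ↦ ?_
        rw [← lintegral_mul_const _ (by fun_prop)]
        simp_rw [mul_assoc]
    _ = _ := by
        simp_rw [hconv]
        rw [← lintegral_const_mul _ (by fun_prop), ← lintegral_indicator measurableSet_Ioi]
        refine lintegral_congr fun r ↦ ?_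
        rw [← Set.indicator_mul_left]
        congr 1; ext r
        rw [ENNReal.ofReal_mul (ProbabilityTheory.beta_pos ha hb).le, mul_assoc]

section HeatKernel

/-- The heat kernel `(4πt)^{-d/2} exp(-|x|²/(4t))`, with values in `[0, ∞]`. -/
noncomputable def heatKernel (t : ℝ) (x : V) : ℝ≥0∞ :=
  ENNReal.ofReal ((4 * π * t) ^ (-(Module.finrank ℝ V / 2 : ℝ)) * exp (-(‖x‖ ^ 2 / (4 * t))))

theorem heatKernel_sub_comm (t : ℝ) (x y : V) : heatKernel t (x - y) = heatKernel t (y - x) := by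
  rw [heatKernel, heatKernel, norm_sub_rev]

/-- A superposition of heat kernels is a Riesz kernel. -/
theorem lintegral_rpow_mul_heatKernel {b : ℝ} (hb : b < Module.finrank ℝ V / 2) {x : V}
    (hx : x ≠ 0) :
    ∫⁻ t in Set.Ioi (0 : ℝ), ENNReal.ofReal (t ^ (b - 1)) * heatKernel t x =
      ENNReal.ofReal (π ^ (-(Module.finrank ℝ V / 2 : ℝ)) * 4 ^ (-b) *
        Gamma (Module.finrank ℝ V / 2 - b) * ‖x‖ ^ (2 * b - Module.finrank ℝ V)) := by
  have hn : 0 < ‖x‖ := norm_pos_iff.2 hx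
  set D : ℝ := Module.finrank ℝ V / 2 with hD
  have hc : 0 < D - b := by linarith
  have hr : 0 < ‖x‖ ^ 2 / 4 := by positivity
  calc _ = ∫⁻ t in Set.Ioi (0 : ℝ), ENNReal.ofReal ((4 * π) ^ (-D)) *
        ENNReal.ofReal (t ^ (-(D - b) - 1) * exp (-(‖x‖ ^ 2 / 4 / t))) := by
        refine setLIntegral_congr_fun measurableSet_Ioi fun t ht ↦ ?_
        have ht : (0 : ℝ) < t := ht
        simp only [heatKernel]
        rw [← ENNReal.ofReal_mul (by positivity), ← ENNReal.ofReal_mul (by positivity), ← hD,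
          mul_rpow (by positivity) ht.le, div_div,
          show -(D - b) - 1 = (b - 1) + (-D) by ring, rpow_add ht]
        congr 1; ring
    _ = _ := by
        rw [lintegral_const_mul' _ _ ENNReal.ofReal_ne_top, lintegral_rpow_mul_exp_neg_div_Ioi hc hr,
          ← ENNReal.ofReal_mul (by positivity)]
        congr 1
        rw [div_rpow (by positivity) (by norm_num), mul_rpow (by norm_num) pi_pos.le,
          ← rpow_natCast ‖x‖ 2, ← rpow_mul hn.le, div_eq_mul_inv,
          ← rpow_neg (by norm_num : (0 : ℝ) ≤ 4), show -b = -D + -(-(D - b)) by ring,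
          rpow_add (by norm_num),
          show ((2 : ℕ) : ℝ) * -(D - b) = 2 * b - Module.finrank ℝ V by push_cast; rw [hD]; ring]
        ring

variable [MeasurableSpace V] [BorelSpace V]

@[fun_prop]
theorem measurable_heatKernel :
    Measurable (fun p : ℝ × V ↦ heatKernel p.1 p.2) := by
  unfold heatKernel; fun_prop

@[fun_prop]
theorem Measurable.heatKernel {Ω : Type*} [MeasurableSpace Ω] {t : Ω → ℝ} {x : Ω → V}
    (ht : Measurable t) (hx : Measurable x) : Measurable fun ω ↦ heatKernel (t ω) (x ω) :=
  measurable_heatKernel.comp (ht.prodMk hx)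

variable [FiniteDimensional ℝ V]

/-- The semigroup property of the heat kernel. -/
theorem lintegral_heatKernel_mul_heatKernel {s t : ℝ} (hs : 0 < s) (ht : 0 < t) (x : V) :
    ∫⁻ y, heatKernel t (x - y) * heatKernel s y = heatKernel (t + s) x := by
  set D : ℝ := Module.finrank ℝ V / 2 with hD
  set m : ℝ := s / (t + s) with hm
  set B : ℝ := (t + s) / (4 * t * s) with hB
  have hBpos : 0 < B := by positivity
  have hts : 0 < t + s := by positivity
  set K : ℝ := (4 * π * t) ^ (-D) * (4 * π * s) ^ (-D) * exp (-(‖x‖ ^ 2 / (4 * (t + s)))) with hK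
  have hG : ∫⁻ y : V, ENNReal.ofReal (exp (-B * ‖y‖ ^ 2)) = ENNReal.ofReal ((π / B) ^ D) := by
    rw [hD, ← GaussianFourier.integral_rexp_neg_mul_sq_norm hBpos,
      ofReal_integral_eq_lintegral_ofReal]
    · refine Integrable.of_integral_ne_zero ?_
      rw [GaussianFourier.integral_rexp_neg_mul_sq_norm hBpos]; positivity
    · exact .of_forall fun _ ↦ (exp_pos _).le
  calc _ = ∫⁻ y, ENNReal.ofReal K * ENNReal.ofReal (exp (-B * ‖y - m • x‖ ^ 2)) := by
        refine lintegral_congr fun y ↦ ?_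
        rw [_root_.heatKernel, _root_.heatKernel, ← ENNReal.ofReal_mul (by positivity),
          ← ENNReal.ofReal_mul (by positivity), ← hD]
        congr 1
        rw [hK, mul_mul_mul_comm, ← exp_add, mul_assoc (_ * _), ← exp_add]
        congr 2
        rw [norm_sub_sq_real x y, norm_sub_sq_real y, norm_smul, inner_smul_right,
          real_inner_comm x y, hm, hB, Real.norm_of_nonneg (by positivity)]
        field_simp
        ring
    _ = _ := by
        rw [lintegral_const_mul' _ _ ENNReal.ofReal_ne_top,
          lintegral_sub_right_eq_self (fun y : V ↦ ENNReal.ofReal (exp (-B * ‖y‖ ^ 2))), hG,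
          ← ENNReal.ofReal_mul (by positivity), _root_.heatKernel, ← hD]
        congr 1
        have : (4 * π * t) ^ (-D) * (4 * π * s) ^ (-D) * (π / B) ^ D
            = (4 * π * (t + s)) ^ (-D) := by
          rw [← mul_rpow (by positivity) (by positivity), rpow_neg (by positivity),
            rpow_neg (by positivity), ← inv_rpow (by positivity), ← inv_rpow (by positivity),
            ← mul_rpow (by positivity) (by positivity)]
          congr 1
          rw [hB]; field_simp
        rw [← this, hK]; ring

/-- Composition of superpositions of heat kernels. -/
theorem lintegral_rpow_mul_heatKernel_comp {a b : ℝ} (ha : 0 < a) (hb : 0 < b) (x : V) :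
    ∫⁻ t in Set.Ioi (0 : ℝ), ENNReal.ofReal (t ^ (a - 1)) * ∫⁻ y, heatKernel t (x - y) *
        ∫⁻ s in Set.Ioi (0 : ℝ), ENNReal.ofReal (s ^ (b - 1)) * heatKernel s y =
      ENNReal.ofReal (ProbabilityTheory.beta a b) *
        ∫⁻ r in Set.Ioi (0 : ℝ), ENNReal.ofReal (r ^ (a + b - 1)) * heatKernel r x := by
  rw [← lintegral_lintegral_rpow_mul_rpow_comp_add ha hb (by fun_prop)]
  refine setLIntegral_congr_fun measurableSet_Ioi fun t ht ↦ ?_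
  congr 1
  calc _ = ∫⁻ y, ∫⁻ s in Set.Ioi (0 : ℝ), heatKernel t (x - y) *
        (ENNReal.ofReal (s ^ (b - 1)) * heatKernel s y) := by
        refine lintegral_congr fun y ↦ ?_
        rw [lintegral_const_mul _ (by fun_prop)]
    _ = ∫⁻ s in Set.Ioi (0 : ℝ), ∫⁻ y, heatKernel t (x - y) *
        (ENNReal.ofReal (s ^ (b - 1)) * heatKernel s y) := lintegral_lintegral_swap (by fun_prop)
    _ = _ := by
        refine setLIntegral_congr_fun measurableSet_Ioi fun s hs ↦ ?_
        simp_rw [mul_left_comm _ (ENNReal.ofReal _)]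
        rw [lintegral_const_mul _ (by fun_prop), lintegral_heatKernel_mul_heatKernel hs ht]

end HeatKernel

section Hardy

variable [FiniteDimensional ℝ V] [MeasurableSpace V] [BorelSpace V]

/-- A Gaussian average of `|𝓕 h|²` is bounded by the heat form of `|h|`. -/
theorem lintegral_gaussian_mul_enorm_fourier_sq_le {h : V → ℂ} (hh : Integrable h)
    {t : ℝ} (ht : 0 < t) :
    ∫⁻ x, ENNReal.ofReal (exp (-(4 * π ^ 2 * ‖x‖ ^ 2 * t))) * ‖𝓕 h x‖ₑ ^ 2 ≤
      ∫⁻ x, ∫⁻ y, heatKernel t (x - y) * (‖h x‖ₑ * ‖h y‖ₑ) := by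
  set β : ℝ := 4 * π ^ 2 * t with hβ
  have hβpos : 0 < β := by positivity
  have hβre : 0 < (β : ℂ).re := by simpa
  set γ : V → ℂ := fun x ↦ Complex.exp (-β * ‖x‖ ^ 2) with hγ
  have hγnorm (x : V) : ‖γ x‖ₑ = ENNReal.ofReal (exp (-(4 * π ^ 2 * ‖x‖ ^ 2 * t))) := by
    rw [← ofReal_norm, hγ, Complex.norm_exp]
    congr 2
    norm_cast
    rw [hβ]; ring
  have hc : Continuous (𝓕 h) := VectorFourier.fourierIntegral_continuous
    Real.continuous_fourierChar continuous_inner hh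
  have hγint : Integrable γ := by
    simpa [hγ] using! GaussianFourier.integrable_cexp_neg_mul_sq_norm_add hβre 0 (0 : V)
  have hbd : ∀ x, ‖𝓕 h x‖ ≤ ∫ v, ‖h v‖ := fun x ↦
    VectorFourier.norm_fourierIntegral_le_integral_norm _ _ _ _ _
  set v : V → ℂ := fun x ↦ γ x * (starRingEnd ℂ) (𝓕 h x) with hv
  have hvint : Integrable v := by
    refine hγint.mul_bdd (c := ∫ v, ‖h v‖) (by fun_prop) (.of_forall fun x ↦ ?_)
    simpa using hbd x
  set h' : V → ℂ := fun y ↦ (starRingEnd ℂ) (h (-y)) with hh'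
  have hh'int : Integrable h' := (Complex.conjCLE.integrable_comp_iff.2 hh).comp_neg
  have hconj : ∀ x, (starRingEnd ℂ) (𝓕 h x) = 𝓕 h' x := by
    intro x
    have : 𝓕 h' x = 𝓕⁻ (fun y ↦ (starRingEnd ℂ) (h y)) x := by
      rw [fourierInv_eq_fourier_comp_neg]
    rw [this, fourier_eq', fourierInv_eq', ← integral_conj]
    refine integral_congr_ae (.of_forall fun y ↦ ?_)
    simp [← Complex.exp_conj, Complex.conj_ofNat]
  have hFv : ∀ ξ, ‖𝓕 v ξ‖ₑ ≤ ∫⁻ y, heatKernel t (ξ - y) * ‖h y‖ₑ := by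
    intro ξ
    have hEint : Integrable
        (fun x : V ↦ Complex.exp (-β * ‖x‖ ^ 2 + 2 * π * Complex.I * inner ℝ (-ξ) x)) :=
      GaussianFourier.integrable_cexp_neg_mul_sq_norm_add hβre _ _
    have h1 : 𝓕 v ξ = ∫ x, 𝓕 h' x *
        Complex.exp (-β * ‖x‖ ^ 2 + 2 * π * Complex.I * inner ℝ (-ξ) x) := by
      rw [fourier_eq']
      refine integral_congr_ae (.of_forall fun x ↦ ?_)
      simp only [hv, hconj, smul_eq_mul, Complex.exp_add, hγ]
      rw [mul_left_comm, mul_comm (𝓕 h' x), inner_neg_left, real_inner_comm ξ x]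
      rw [mul_right_comm, ← mul_assoc, mul_right_comm, mul_assoc]
      push_cast
      ring_nf
    have hnorm (y : V) : ‖h' y * 𝓕 (fun x : V ↦ Complex.exp
        (-β * ‖x‖ ^ 2 + 2 * π * Complex.I * inner ℝ (-ξ) x)) y‖ₑ =
        heatKernel t (ξ - -y) * ‖h (-y)‖ₑ := by
      rw [fourier_gaussian_innerProductSpace' hβre, enorm_mul, mul_comm]
      congr 1
      · rw [heatKernel, ← ofReal_norm, norm_mul, Complex.norm_exp]
        congr 2
        · rw [← Complex.ofReal_div, ← Complex.ofReal_natCast, ← Complex.ofReal_ofNat,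
            ← Complex.ofReal_div, ← Complex.ofReal_cpow (by positivity), Complex.norm_real,
            Real.norm_of_nonneg (by positivity), rpow_neg (by positivity),
            ← inv_rpow (by positivity)]
          congr 1
          rw [hβ]; field_simp
        · norm_cast
          rw [hβ, ← norm_neg, neg_sub, sub_neg_eq_add, sub_neg_eq_add, add_comm y ξ]
          field_simp
      · simp [hh']
    rw [h1, integral_fourier_mul_eq_of_integrable hh'int hEint]
    refine (enorm_integral_le_lintegral_enorm _).trans_eq ?_
    simp_rw [hnorm]
    exact lintegral_neg_eq_self (fun y ↦ heatKernel t (ξ - y) * ‖h y‖ₑ)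
  have hpt (x : V) : 𝓕 h x * v x =
      ((exp (-(4 * π ^ 2 * ‖x‖ ^ 2 * t)) * ‖𝓕 h x‖ ^ 2 : ℝ) : ℂ) := by
    simp only [hv, hγ]
    rw [mul_left_comm, Complex.mul_conj, Complex.normSq_eq_norm_sq]
    push_cast
    rw [hβ]; push_cast; ring_nf
  calc _ = ‖∫ x, 𝓕 h x * v x‖ₑ := by
        simp_rw [hpt]
        rw [integral_complex_ofReal, ← ofReal_norm, Complex.norm_real,
          Real.norm_of_nonneg (integral_nonneg fun _ ↦ by positivity),
          ofReal_integral_eq_lintegral_ofReal _ (.of_forall fun _ ↦ by positivity)]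
        · refine lintegral_congr fun x ↦ ?_
          rw [ENNReal.ofReal_mul (by positivity), ENNReal.ofReal_pow (norm_nonneg _), ofReal_norm]
        · have h1 : Integrable (fun x ↦ 𝓕 h x * v x) :=
            hvint.bdd_mul hc.aestronglyMeasurable (.of_forall hbd)
          simp_rw [hpt] at h1
          exact Complex.reCLM.integrable_comp h1
    _ = ‖∫ x, h x * 𝓕 v x‖ₑ := by rw [integral_fourier_mul_eq_of_integrable hh hvint]
    _ ≤ ∫⁻ x, ‖h x‖ₑ * ‖𝓕 v x‖ₑ := by
        simp_rw [← enorm_mul]; exact enorm_integral_le_lintegral_enorm _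
    _ ≤ ∫⁻ x, ‖h x‖ₑ * ∫⁻ y, heatKernel t (x - y) * ‖h y‖ₑ := by
        gcongr with x; exact hFv x
    _ = _ := by
        refine lintegral_congr fun x ↦ ?_
        rw [← lintegral_const_mul' _ _ enorm_ne_top]
        simp_rw [mul_left_comm]

/-- Schur test for a symmetric kernel. -/
theorem lintegral_lintegral_symm_kernel_le {X : Type*} [MeasurableSpace X] {μ : Measure X}
    [SFinite μ] {K : X → X → ℝ≥0∞} (hK : Measurable (Function.uncurry K))
    (hsymm : ∀ x y, K x y = K y x) {u W : X → ℝ≥0∞} (hu : Measurable u) (hW : Measurable W)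
    (hW0 : ∀ᵐ x ∂μ, W x ≠ 0) (hW1 : ∀ᵐ x ∂μ, W x ≠ ∞) (hu1 : ∀ x, u x ≠ ∞) :
    ∫⁻ x, ∫⁻ y, K x y * (u x * u y) ∂μ ∂μ ≤
      ∫⁻ x, ∫⁻ y, K x y * (u x ^ 2 * (W y / W x)) ∂μ ∂μ := by
  have amgm (u v p q : ℝ≥0∞) (hu : u ≠ ∞) (hv : v ≠ ∞) (hp : p ≠ 0) (hp1 : p ≠ ∞) (hq : q ≠ 0)
      (hq1 : q ≠ ∞) : 2 * (u * v) ≤ u ^ 2 * (q / p) + v ^ 2 * (p / q) := by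
    lift u to NNReal using hu
    lift v to NNReal using hv
    lift p to NNReal using hp1
    lift q to NNReal using hq1
    have hp : p ≠ 0 := by simpa using hp
    have hq : q ≠ 0 := by simpa using hq
    rw [← ENNReal.coe_div hp, ← ENNReal.coe_div hq]
    norm_cast
    rw [← NNReal.coe_le_coe]
    have hp' : (0 : ℝ) < p := by positivity
    have hq' : (0 : ℝ) < q := by positivity
    push_cast
    have : (u : ℝ) ^ 2 * (q / p) + v ^ 2 * (p / q) - 2 * (u * v) = (u * q - v * p) ^ 2 / (p * q) := by
      field_simp; ring
    have h2 : (0 : ℝ) ≤ (u * q - v * p) ^ 2 / (p * q) := by positivity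
    linarith
  have hK' : Measurable fun p : X × X ↦ K p.1 p.2 := hK
  have hK2 : Measurable fun p : X × X ↦ K p.2 p.1 := hK.comp measurable_swap
  set R := ∫⁻ x, ∫⁻ y, K x y * (u x ^ 2 * (W y / W x)) ∂μ ∂μ with hR
  have hswap : ∫⁻ x, ∫⁻ y, K x y * (u y ^ 2 * (W x / W y)) ∂μ ∂μ = R := by
    rw [lintegral_lintegral_swap (by fun_prop), hR]
    simp_rw [hsymm]
  have h2 : 2 * ∫⁻ x, ∫⁻ y, K x y * (u x * u y) ∂μ ∂μ ≤ 2 * R := by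
    calc _ = ∫⁻ x, ∫⁻ y, K x y * (2 * (u x * u y)) ∂μ ∂μ := by
          rw [← lintegral_const_mul' _ _ (by simp)]
          refine lintegral_congr fun x ↦ ?_
          rw [← lintegral_const_mul' _ _ (by simp)]
          simp_rw [mul_left_comm]
      _ ≤ ∫⁻ x, ∫⁻ y, (K x y * (u x ^ 2 * (W y / W x)) + K x y * (u y ^ 2 * (W x / W y))) ∂μ ∂μ := by
          refine lintegral_mono_ae ?_
          filter_upwards [hW0, hW1] with x hx0 hx1
          refine lintegral_mono_ae ?_
          filter_upwards [hW0, hW1] with y hy0 hy1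
          rw [← mul_add]
          gcongr
          exact amgm _ _ _ _ (hu1 x) (hu1 y) hx0 hx1 hy0 hy1
      _ = 2 * R := by
          rw [two_mul]
          nth_rw 2 [← hswap]
          rw [← lintegral_add_left (by fun_prop)]
          refine lintegral_congr fun x ↦ ?_
          rw [lintegral_add_left]
          have : Measurable (K x) := hK.of_uncurry_left
          fun_prop
  exact (ENNReal.mul_le_mul_iff_right (by simp) (by simp)).1 h2

theorem lintegral_mul_lintegral_eq_lintegral_lintegral_mul {X Y : Type*} [MeasurableSpace X]
    [MeasurableSpace Y] {μ : Measure X} {ν : Measure Y} [SFinite μ] [SFinite ν] {f : X → ℝ≥0∞}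
    {Φ : X × Y → ℝ≥0∞} (hf : Measurable f) (hΦ : Measurable Φ) :
    ∫⁻ x, f x * ∫⁻ y, Φ (x, y) ∂ν ∂μ = ∫⁻ y, ∫⁻ x, f x * Φ (x, y) ∂μ ∂ν := by
  rw [lintegral_lintegral_swap (by fun_prop)]
  refine lintegral_congr fun x ↦ ?_
  rw [lintegral_const_mul _ (by fun_prop)]

/-- The sharp Hardy inequality for `|p|^α`, on the Fourier side. -/
theorem lintegral_rpow_neg_mul_enorm_fourier_sq_le {α : ℝ} (hα : 0 < α)
    (hαd : α < Module.finrank ℝ V / 2) {h : V → ℂ} (hm : Measurable h) (hh : Integrable h) :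
    ∫⁻ x, ENNReal.ofReal (‖x‖ ^ (-(2 * α))) * ‖𝓕 h x‖ₑ ^ 2 ≤
      ENNReal.ofReal (2 ^ (2 * α) * Gamma ((Module.finrank ℝ V + 2 * α) / 4) ^ 2 /
        Gamma ((Module.finrank ℝ V - 2 * α) / 4) ^ 2)⁻¹ *
        ∫⁻ ξ, ENNReal.ofReal ((2 * π * ‖ξ‖) ^ (2 * α)) * ‖h ξ‖ₑ ^ 2 := by
  set d : ℝ := ((Module.finrank ℝ V : ℕ) : ℝ) with hd
  set b : ℝ := (d - 2 * α) / 4 with hb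
  set c : ℝ := (d + 2 * α) / 4 with hc
  have hbpos : 0 < b := by rw [hb]; linarith
  have hcpos : 0 < c := by rw [hc]; linarith
  have hαb : α + b = c := by rw [hb, hc]; ring
  have hbd : b < d / 2 := by rw [hb]; linarith
  have hcd : c < d / 2 := by rw [hc]; linarith
  have hdb : d / 2 - b = c := by rw [hb, hc]; ring
  have hdc : d / 2 - c = b := by rw [hb, hc]; ring
  have hΓα := Gamma_pos_of_pos hα
  have hΓb := Gamma_pos_of_pos hbpos
  have hΓc := Gamma_pos_of_pos hcpos
  have : Nontrivial V := Module.nontrivial_of_finrank_pos (R := ℝ) <| by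
    have : (0 : ℝ) < d := by linarith
    rw [hd] at this
    exact_mod_cast this
  have hne : ∀ᵐ x : V, x ≠ 0 := by simp [ae_iff]
  have hcont : Continuous (𝓕 h) := VectorFourier.fourierIntegral_continuous
    Real.continuous_fourierChar continuous_inner hh
  set W : V → ℝ≥0∞ := fun x ↦
    ∫⁻ t in Set.Ioi (0 : ℝ), ENNReal.ofReal (t ^ (b - 1)) * heatKernel t x with hW
  have hWm : Measurable W := by
    rw [hW]; exact Measurable.lintegral_prod_right' (f := fun p : V × ℝ ↦
      ENNReal.ofReal (p.2 ^ (b - 1)) * heatKernel p.2 p.1) (by fun_prop)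
  have hWval : ∀ x : V, x ≠ 0 → W x = ENNReal.ofReal (π ^ (-(d / 2)) * 4 ^ (-b) *
      Gamma c * ‖x‖ ^ (2 * b - d)) := by
    intro x hx
    simp only [hW]
    rw [lintegral_rpow_mul_heatKernel hbd hx, ← hd, hdb]
  have hW1 : ∀ᵐ x, W x ≠ ∞ := by
    filter_upwards [hne] with x hx
    rw [hWval x hx]; exact ENNReal.ofReal_ne_top
  have hW0 : ∀ᵐ x, W x ≠ 0 := by
    filter_upwards [hne] with x hx
    have := norm_pos_iff.2 hx
    rw [hWval x hx, ENNReal.ofReal_ne_zero_iff]; positivity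
  set κ : ℝ := Gamma α * (4 * π ^ 2) ^ (-α) with hκ
  have hκpos : 0 < κ := by positivity
  set H : ℝ := 2 ^ (2 * α) * Gamma c ^ 2 / Gamma b ^ 2 with hH
  have hHpos : 0 < H := by positivity
  have hfinal : ∀ x : V, x ≠ 0 → ENNReal.ofReal (ProbabilityTheory.beta α b) *
      (∫⁻ r in Set.Ioi (0 : ℝ), ENNReal.ofReal (r ^ (α + b - 1)) * heatKernel r x) / W x =
      ENNReal.ofReal (κ * H⁻¹) * ENNReal.ofReal ((2 * π * ‖x‖) ^ (2 * α)) := by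
    intro x hx
    have hn := norm_pos_iff.2 hx
    rw [hWval x hx, hαb, lintegral_rpow_mul_heatKernel hcd hx, ← hd, hdc,
      ← ENNReal.ofReal_mul (ProbabilityTheory.beta_pos hα hbpos).le,
      ← ENNReal.ofReal_div_of_pos (by positivity), ← ENNReal.ofReal_mul (by positivity)]
    congr 1
    rw [ProbabilityTheory.beta, hαb, hκ, hH]
    have e1 : ‖x‖ ^ (2 * c - d) = ‖x‖ ^ (2 * b - d) * ‖x‖ ^ (2 * α) := by
      rw [← rpow_add hn]; congr 1; rw [← hαb]; ring
    have e2 : (4 : ℝ) ^ (-c) = 4 ^ (-b) * 4 ^ (-α) := by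
      rw [← rpow_add (by norm_num)]; congr 1; rw [← hαb]; ring
    have e3 : (2 : ℝ) ^ (2 * α) = 4 ^ α := by
      rw [rpow_mul (by norm_num)]; norm_num
    have e4 : (2 * π * ‖x‖) ^ (2 * α) = (4 * π ^ 2) ^ α * ‖x‖ ^ (2 * α) := by
      rw [mul_rpow (by positivity) hn.le, rpow_mul (by positivity)]
      congr 2; norm_cast; ring
    rw [e1, e2, e3, e4, rpow_neg (by norm_num) α, rpow_neg (by positivity) α]
    have hp1 : (4 : ℝ) ^ α ≠ 0 := by positivity
    have hp2 : (4 * π ^ 2) ^ α ≠ 0 := by positivity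
    field_simp
  have key : ENNReal.ofReal κ * ∫⁻ x, ENNReal.ofReal (‖x‖ ^ (-(2 * α))) * ‖𝓕 h x‖ₑ ^ 2 ≤
      ENNReal.ofReal κ * (ENNReal.ofReal H⁻¹ *
        ∫⁻ ξ, ENNReal.ofReal ((2 * π * ‖ξ‖) ^ (2 * α)) * ‖h ξ‖ₑ ^ 2) := by
    calc _ = ∫⁻ x, ∫⁻ t in Set.Ioi (0 : ℝ), ENNReal.ofReal (t ^ (α - 1)) *
          (ENNReal.ofReal (exp (-(4 * π ^ 2 * ‖x‖ ^ 2 * t))) * ‖𝓕 h x‖ₑ ^ 2) := by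
          rw [← lintegral_const_mul' _ _ ENNReal.ofReal_ne_top]
          refine lintegral_congr_ae ?_
          filter_upwards [hne] with x hx
          have hn := norm_pos_iff.2 hx
          simp_rw [← mul_assoc]
          rw [lintegral_mul_const' _ _ (by simp)]
          congr 1
          rw [← ENNReal.ofReal_mul hκpos.le]
          calc _ = ENNReal.ofReal (Gamma α * (4 * π ^ 2 * ‖x‖ ^ 2) ^ (-α)) := by
                congr 1
                rw [hκ, mul_rpow (x := 4 * π ^ 2) (by positivity) (by positivity), ← rpow_natCast ‖x‖ 2,
                  ← rpow_mul hn.le]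
                push_cast
                rw [mul_neg, mul_assoc]
            _ = _ := by
                rw [← lintegral_rpow_mul_exp_neg_mul_Ioi hα (by positivity)]
                refine setLIntegral_congr_fun measurableSet_Ioi fun t ht ↦ ?_
                exact ENNReal.ofReal_mul (rpow_nonneg (le_of_lt ht) _)
      _ = ∫⁻ t in Set.Ioi (0 : ℝ), ENNReal.ofReal (t ^ (α - 1)) * ∫⁻ x,
          ENNReal.ofReal (exp (-(4 * π ^ 2 * ‖x‖ ^ 2 * t))) * ‖𝓕 h x‖ₑ ^ 2 := by
          exact (lintegral_mul_lintegral_eq_lintegral_lintegral_mul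
            (f := fun t : ℝ ↦ ENNReal.ofReal (t ^ (α - 1))) (Φ := fun p : ℝ × V ↦
            ENNReal.ofReal (exp (-(4 * π ^ 2 * ‖p.2‖ ^ 2 * p.1))) * ‖𝓕 h p.2‖ₑ ^ 2)
            (by fun_prop) (Measurable.mul (by fun_prop)
              ((hcont.measurable.comp measurable_snd).enorm.pow_const 2))).symm
      _ ≤ ∫⁻ t in Set.Ioi (0 : ℝ), ENNReal.ofReal (t ^ (α - 1)) *
          ∫⁻ x, ∫⁻ y, heatKernel t (x - y) * (‖h x‖ₑ ^ 2 * (W y / W x)) := by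
          refine setLIntegral_mono' measurableSet_Ioi fun t ht ↦ ?_
          refine mul_le_mul' le_rfl ?_
          refine (lintegral_gaussian_mul_enorm_fourier_sq_le hh ht).trans ?_
          exact lintegral_lintegral_symm_kernel_le
            (K := fun x y ↦ heatKernel t (x - y)) (u := fun x ↦ ‖h x‖ₑ)
            (by unfold Function.uncurry; fun_prop)
            (fun x y ↦ heatKernel_sub_comm t x y) (by fun_prop) hWm hW0 hW1 (by simp)
      _ = ∫⁻ x, ∫⁻ t in Set.Ioi (0 : ℝ), ENNReal.ofReal (t ^ (α - 1)) *
          ∫⁻ y, heatKernel t (x - y) * (‖h x‖ₑ ^ 2 * (W y / W x)) := by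
          have hmeas : Measurable fun p : ℝ × V ↦
              ∫⁻ y, heatKernel p.1 (p.2 - y) * (‖h p.2‖ₑ ^ 2 * (W y / W p.2)) :=
            Measurable.lintegral_prod_right' (f := fun q : (ℝ × V) × V ↦
              heatKernel q.1.1 (q.1.2 - q.2) * (‖h q.1.2‖ₑ ^ 2 * (W q.2 / W q.1.2))) (by fun_prop)
          exact lintegral_mul_lintegral_eq_lintegral_lintegral_mul (by fun_prop) hmeas
      _ = ∫⁻ x, ENNReal.ofReal (κ * H⁻¹) *
          (ENNReal.ofReal ((2 * π * ‖x‖) ^ (2 * α)) * ‖h x‖ₑ ^ 2) := by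
          refine lintegral_congr_ae ?_
          filter_upwards [hne, hW0] with x hx hx0
          have hfin : ‖h x‖ₑ ^ 2 / W x ≠ ∞ := ENNReal.div_ne_top (by simp) hx0
          rw [← mul_assoc, ← hfinal x hx, ← lintegral_rpow_mul_heatKernel_comp hα hbpos]
          rw [div_eq_mul_inv, mul_assoc, mul_comm (W x)⁻¹, ← div_eq_mul_inv,
            ← lintegral_mul_const' _ _ hfin]
          refine lintegral_congr fun t ↦ ?_
          rw [mul_assoc, ← lintegral_mul_const' _ _ hfin]
          congr 1
          refine lintegral_congr fun y ↦ ?_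
          change _ = heatKernel t (x - y) * W y * _
          simp only [div_eq_mul_inv]
          ring
      _ = _ := by
          rw [lintegral_const_mul' _ _ ENNReal.ofReal_ne_top, ENNReal.ofReal_mul hκpos.le, mul_assoc]
  exact (ENNReal.mul_le_mul_iff_right (by simpa using hκpos) (by simp)).1 key

end Hardy

/-- The sharp Hardy inequality for Schwartz functions. -/
theorem eLpNorm_rpow_neg_mul_schwartz_le {d : ℕ} {α : ℝ} (hα : 0 < α) (hαd : α < (d : ℝ) / 2)
    (f : 𝓢(EuclideanSpace ℝ (Fin d), ℂ)) :
    eLpNorm (fun x ↦ ((‖x‖ ^ (-α) : ℝ) : ℂ) * f x) 2 volume ≤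
      ENNReal.ofReal ((2 ^ (2 * α) * Gamma (((d : ℝ) + 2 * α) / 4) ^ 2 /
        Gamma (((d : ℝ) - 2 * α) / 4) ^ 2) ^ (-(1 : ℝ) / 2)) *
      eLpNorm (fun ξ ↦ (((2 * π * ‖ξ‖) ^ α : ℝ) : ℂ) * 𝓕 (⇑f) ξ) 2 volume := by
  have hΓ1 : 0 < Gamma (((d : ℝ) - 2 * α) / 4) := Gamma_pos_of_pos (by linarith)
  have hΓ2 : 0 < Gamma (((d : ℝ) + 2 * α) / 4) := Gamma_pos_of_pos (by positivity)
  set h : EuclideanSpace ℝ (Fin d) → ℂ := fun ξ ↦ 𝓕 (⇑f) (-ξ) with hh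
  have hFint : Integrable (𝓕 (⇑f)) := (𝓕 f).integrable
  have hFcont : Continuous (𝓕 (⇑f)) := (𝓕 f).continuous
  have hfh : 𝓕 h = f := by
    rw [← f.continuous.fourierInv_fourier_eq f.integrable hFint]
    exact (fourierInv_eq_fourier_comp_neg _).symm
  have key := lintegral_rpow_neg_mul_enorm_fourier_sq_le (V := EuclideanSpace ℝ (Fin d)) hα
    (by simpa using hαd) (h := h) (by fun_prop) hFint.comp_neg
  rw [hfh, finrank_euclideanSpace_fin] at key
  set H : ℝ := 2 ^ (2 * α) * Gamma (((d : ℝ) + 2 * α) / 4) ^ 2 /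
    Gamma (((d : ℝ) - 2 * α) / 4) ^ 2 with hH
  have hHpos : 0 < H := by positivity
  rw [eLpNorm_eq_lintegral_rpow_enorm_toReal (by simp) (by simp),
    eLpNorm_eq_lintegral_rpow_enorm_toReal (by simp) (by simp)]
  have e0 : H ^ (-(1 : ℝ) / 2) = H⁻¹ ^ (1 / (2 : ℝ)) := by
    rw [inv_rpow hHpos.le, ← rpow_neg hHpos.le]; congr 1; ring
  simp only [ENNReal.toReal_ofNat, ENNReal.rpow_ofNat]
  rw [e0, ← ENNReal.ofReal_rpow_of_pos (by positivity), ← ENNReal.mul_rpow_of_nonneg _ _ (by simp)]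
  refine ENNReal.rpow_le_rpow ?_ (by simp)
  have hsq (r : ℝ) (hr : 0 ≤ r) (z : ℂ) :
      ‖((r ^ α : ℝ) : ℂ) * z‖ₑ ^ 2 = ENNReal.ofReal (r ^ (2 * α)) * ‖z‖ₑ ^ 2 := by
    rw [enorm_mul, mul_pow, ← ofReal_norm, Complex.norm_real, Real.norm_of_nonneg (by positivity),
      ← ENNReal.ofReal_pow (by positivity), ← rpow_natCast, ← rpow_mul hr, mul_comm α]
    norm_cast
  have hsq' (r : ℝ) (hr : 0 ≤ r) (z : ℂ) :
      ‖((r ^ (-α) : ℝ) : ℂ) * z‖ₑ ^ 2 = ENNReal.ofReal (r ^ (-(2 * α))) * ‖z‖ₑ ^ 2 := by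
    rw [rpow_neg_eq_inv_rpow, rpow_neg_eq_inv_rpow, hsq _ (by positivity)]
  have hl : ∫⁻ x : EuclideanSpace ℝ (Fin d), ‖((‖x‖ ^ (-α) : ℝ) : ℂ) * f x‖ₑ ^ 2 =
      ∫⁻ x, ENNReal.ofReal (‖x‖ ^ (-(2 * α))) * ‖f x‖ₑ ^ 2 :=
    lintegral_congr fun x ↦ hsq' _ (norm_nonneg x) _
  have hr : ∫⁻ ξ : EuclideanSpace ℝ (Fin d), ‖(((2 * π * ‖ξ‖) ^ α : ℝ) : ℂ) * 𝓕 (⇑f) ξ‖ₑ ^ 2 =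
      ∫⁻ ξ, ENNReal.ofReal ((2 * π * ‖ξ‖) ^ (2 * α)) * ‖h ξ‖ₑ ^ 2 := by
    rw [← lintegral_neg_eq_self]
    refine lintegral_congr fun ξ ↦ ?_
    rw [hsq _ (by positivity), norm_neg]
  rw [hl, hr]
  exact key

/-- For `0 < α < d/2` and `|a| < 𝓗_{d,2α}^{1/2}`, with `|p|^α f` the inverse Fourier
transform of `ξ ↦ (2π|ξ|)^α 𝓕f(ξ)`, one has
`‖|p|^α f + a |x|^{-α} f‖_{L²} ≥ (1 - |a| 𝓗_{d,2α}^{-1/2}) ‖|p|^α f‖_{L²}`, where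
`𝓗_{d,2α} = 2^{2α} Γ((d+2α)/4)² / Γ((d-2α)/4)²`. -/
theorem hardy_lower_bound (d : ℕ) (hd : 1 ≤ d) (α : ℝ) (hα : 0 < α)
    (hαd : α < (d : ℝ) / 2) (a : ℝ)
    (ha : |a| < (2 ^ (2 * α) * Real.Gamma (((d : ℝ) + 2 * α) / 4) ^ 2 /
        Real.Gamma (((d : ℝ) - 2 * α) / 4) ^ 2) ^ ((1 : ℝ) / 2))
    (f : SchwartzMap (EuclideanSpace ℝ (Fin d)) ℂ) :
    eLpNorm (fun x : EuclideanSpace ℝ (Fin d) =>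
        𝓕⁻ (fun ξ : EuclideanSpace ℝ (Fin d) =>
            (((2 * π * ‖ξ‖) ^ α : ℝ) : ℂ) * 𝓕 (⇑f) ξ) x
          + ((a * ‖x‖ ^ (-α) : ℝ) : ℂ) * f x) 2 volume
      ≥ ENNReal.ofReal
          (1 - |a| * (2 ^ (2 * α) * Real.Gamma (((d : ℝ) + 2 * α) / 4) ^ 2 /
              Real.Gamma (((d : ℝ) - 2 * α) / 4) ^ 2) ^ (-(1 : ℝ) / 2)) *
        eLpNorm (fun x : EuclideanSpace ℝ (Fin d) =>
          𝓕⁻ (fun ξ : EuclideanSpace ℝ (Fin d) =>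
            (((2 * π * ‖ξ‖) ^ α : ℝ) : ℂ) * 𝓕 (⇑f) ξ) x) 2 volume := by

  set H : ℝ := 2 ^ (2 * α) * Real.Gamma (((d : ℝ) + 2 * α) / 4) ^ 2 /
        Real.Gamma (((d : ℝ) - 2 * α) / 4) ^ 2 with hH
  have hH0 : 0 ≤ H := by positivity
  set g : EuclideanSpace ℝ (Fin d) → ℂ := fun ξ ↦ (((2 * π * ‖ξ‖) ^ α : ℝ) : ℂ) * 𝓕 (⇑f) ξ with hg
  have hgm : AEStronglyMeasurable g := by
    have hFcont : Continuous (𝓕 (⇑f)) := (𝓕 f).continuous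
    exact Measurable.aestronglyMeasurable (by fun_prop)
  obtain ⟨S, hS⟩ := exists_schwartz_norm_rpow_mul_le hα.le (c := 2 * π) (by positivity) (𝓕 f)
  replace hS : ∀ x, ‖g x‖ ≤ ‖S x‖ := hS
  have hgint : Integrable g := S.integrable.mono hgm (.of_forall hS)
  have hg2 : MemLp g 2 := (S.memLp 2 volume).mono hgm (.of_forall hS)
  have hP : eLpNorm (fun x ↦ 𝓕⁻ g x) 2 volume = eLpNorm g 2 volume :=
    eLpNorm_fourierInv_eq hgint hg2
  have hGm : AEStronglyMeasurable (𝓕⁻ g) := by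
    have : Continuous (𝓕⁻ g) := VectorFourier.fourierIntegral_continuous
      Real.continuous_fourierChar (L := -innerₗ _) (by simp; fun_prop) hgint
    exact this.aestronglyMeasurable
  have hhardy := eLpNorm_rpow_neg_mul_schwartz_le hα hαd f
  rw [← hH, ← hg, ← hP] at hhardy
  set N := eLpNorm (fun x ↦ 𝓕⁻ g x) 2 volume with hN
  have hNtop : N ≠ ∞ := by rw [hP]; exact hg2.eLpNorm_ne_top
  set q : EuclideanSpace ℝ (Fin d) → ℂ := fun x ↦ ((a * ‖x‖ ^ (-α) : ℝ) : ℂ) * f x with hq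
  have hqm : AEStronglyMeasurable q := by
    have := f.continuous
    exact Measurable.aestronglyMeasurable (by fun_prop)
  have hqle : eLpNorm q 2 volume ≤ ENNReal.ofReal (|a| * H ^ (-(1 : ℝ) / 2)) * N := by
    have : q = a • fun x ↦ ((‖x‖ ^ (-α) : ℝ) : ℂ) * f x := by
      ext x; simp [hq, mul_assoc]
    rw [this, eLpNorm_const_smul, ENNReal.ofReal_mul (abs_nonneg a), mul_assoc,
      Real.enorm_eq_ofReal_abs]
    gcongr
  have htri : N ≤ eLpNorm (fun x ↦ 𝓕⁻ g x + q x) 2 volume + eLpNorm q 2 volume := by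
    have h1 := eLpNorm_sub_le (hGm.add hqm) hqm (p := 2) (by norm_num)
    rwa [add_sub_cancel_right] at h1
  have hnn : 0 ≤ |a| * H ^ (-(1 : ℝ) / 2) := by positivity
  rw [ge_iff_le, ENNReal.ofReal_sub _ hnn, ENNReal.ofReal_one, ENNReal.sub_mul (by simp [hNtop]),
    one_mul, tsub_le_iff_right]
  exact htri.trans (by gcongr)
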